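/- arXiv:2402.06310 — 2 statements merged into one kernel-verified Lean document; each statement's English description precedes it below -/
import Mathlib

section
/- Let ξ, ξ̄ : Fin n × Fin 2 → ℂ be any pair of vectors and let g_S be the associated spin g-tensor. Then every entry of g_S is real, i.e. conj(g_S(i, j)) = g_S(i, j) for all i, j ∈ {1, 2, 3}. -/
open Matrix Complex

/-- The three Pauli matrices: `pauli 0 = σ₁`, `pauli 1 = σ₂`, `pauli 2 = σ₃`. -/
noncomputable def pauli : Fin 3 → Matrix (Fin 2) (Fin 2) ℂ
  | 0 => !![0, 1; 1, 0]
  | 1 => !![0, -Complex.I; Complex.I, 0]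
  | 2 => !![1, 0; 0, -1]

/-- The Kramers partner of a vector `ξ : ℂⁿ ⊗ ℂ²` (spin index `0` = up, `1` = down):
`ξ̄(a,0) = conj ξ(a,1)`, `ξ̄(a,1) = -conj ξ(a,0)`. -/
noncomputable def kramers {n : ℕ} (ξ : Fin n × Fin 2 → ℂ) : Fin n × Fin 2 → ℂ :=
  fun p => if p.2 = 0 then (starRingEnd ℂ) (ξ (p.1, 1)) else -(starRingEnd ℂ) (ξ (p.1, 0))

/-- Inner product `⟨u, v⟩ = Σ_{a,s} conj(u(a,s)) · v(a,s)` on `ℂⁿ ⊗ ℂ²`. -/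
noncomputable def inner' {n : ℕ} (u v : Fin n × Fin 2 → ℂ) : ℂ :=
  ∑ p : Fin n × Fin 2, (starRingEnd ℂ) (u p) * v p

/-- Norm `‖u‖ = √⟨u,u⟩`. -/
noncomputable def norm' {n : ℕ} (u : Fin n × Fin 2 → ℂ) : ℝ :=
  Real.sqrt (inner' u u).re

/-- Action of the spin operator `σᵢ` on `ℂⁿ ⊗ ℂ²`:
`(σᵢ ξ)(a, s) = Σ_{s'} σᵢ(s, s') · ξ(a, s')`. -/
noncomputable def spinAct {n : ℕ} (i : Fin 3) (ξ : Fin n × Fin 2 → ℂ) : Fin n × Fin 2 → ℂ :=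
  fun p => ∑ s' : Fin 2, pauli i p.2 s' * ξ (p.1, s')

/-- Reduced spin density matrix `ρ_S(ξ)(s,s') = Σ_a ξ(a,s) · conj(ξ(a,s'))`. -/
noncomputable def rhoS {n : ℕ} (ξ : Fin n × Fin 2 → ℂ) : Matrix (Fin 2) (Fin 2) ℂ :=
  Matrix.of fun s s' => ∑ a : Fin n, ξ (a, s) * (starRingEnd ℂ) (ξ (a, s'))

/-- The 2×2 matrix of matrix elements of `σᵢ` in the pair `(ξ, ξ̄)`. -/
noncomputable def SigmaMat {n : ℕ} (ξ ξb : Fin n × Fin 2 → ℂ) (i : Fin 3) :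
    Matrix (Fin 2) (Fin 2) ℂ :=
  !![inner' ξ (spinAct i ξ), inner' ξ (spinAct i ξb);
     inner' ξb (spinAct i ξ), inner' ξb (spinAct i ξb)]

/-- The spin g-tensor of the pair `(ξ, ξ̄)`: `g_S(i,j) = Tr(Σᵢ σⱼ)`. -/
noncomputable def gS {n : ℕ} (ξ ξb : Fin n × Fin 2 → ℂ) : Matrix (Fin 3) (Fin 3) ℂ :=
  Matrix.of fun i j => (SigmaMat ξ ξb i * pauli j).trace

theorem inner'_spinAct_conj {n : ℕ} (u v : Fin n × Fin 2 → ℂ) (i : Fin 3) :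
    (starRingEnd ℂ) (inner' u (spinAct i v)) = inner' v (spinAct i u) := by
  unfold inner' spinAct
  rw [map_sum, Fintype.sum_prod_type, Fintype.sum_prod_type]
  refine Finset.sum_congr rfl fun a _ => ?_
  fin_cases i <;> simp [pauli, Fin.sum_univ_two] <;> ring

/-- Every entry of the spin g-tensor of any pair of vectors is real. -/
theorem stmt7 {n : ℕ} (ξ ξb : Fin n × Fin 2 → ℂ) (i j : Fin 3) :
    (starRingEnd ℂ) (gS ξ ξb i j) = gS ξ ξb i j := by
  have h1 := inner'_spinAct_conj ξ ξ i
  have h2 := inner'_spinAct_conj ξ ξb i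
  have h3 := inner'_spinAct_conj ξb ξ i
  have h4 := inner'_spinAct_conj ξb ξb i
  fin_cases j <;>
    simp [gS, SigmaMat, pauli, Matrix.trace_fin_two, Matrix.mul_apply, Fin.sum_univ_two,
      h1, h2, h3, h4] <;> ring
end

section
/- Let H : ℝ → Matrix (Fin d) (Fin d) ℂ be a differentiable family of Hermitian matrices (H(t)† = H(t) for all t), let u, w : ℝ → (Fin d → ℂ) be differentiable vector-valued functions and E_u, E_w : ℝ → ℝ differentiable real functions such that for all t: H(t) · u(t) = E_u(t) · u(t), H(t) · w(t) = E_w(t) · w(t), and ⟨w(t), u(t)⟩ = 0. Then for all t, ⟨w(t), H'(t) · u(t)⟩ = (E_u(t) − E_w(t)) · ⟨w(t), u'(t)⟩, where H', u' denote derivatives in t and ⟨x, y⟩ = Σᵢ conj(xᵢ) · yᵢ. (Off-diagonal Hellmann–Feynman identity: the matrix element of the derivative of the Bloch state against another eigenstate is the matrix element of the derivative of the Hamiltonian divided by the energy difference, Eq. (13) of the paper.) -/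
open Matrix Complex

/-- Off-diagonal Hellmann–Feynman identity (Eq. (13) of the paper): for a
differentiable family of Hermitian matrices `H t` with differentiable eigenpairs
`(E_u t, u t)` and `(E_w t, w t)` that are mutually orthogonal,
`⟨w, H' u⟩ = (E_u - E_w) ⟨w, u'⟩`. Differentiability of the matrix and vector
families is entrywise, witnessed by the derivative families `H'`, `u'`, `w'`. -/
theorem stmt17 {d : ℕ}
    (H H' : ℝ → Matrix (Fin d) (Fin d) ℂ)
    (u u' w w' : ℝ → (Fin d → ℂ))
    (Eu Ew : ℝ → ℝ)
    (hHdiff : ∀ (i j : Fin d) (t : ℝ), HasDerivAt (fun s => H s i j) (H' t i j) t)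
    (hudiff : ∀ (i : Fin d) (t : ℝ), HasDerivAt (fun s => u s i) (u' t i) t)
    (hwdiff : ∀ (i : Fin d) (t : ℝ), HasDerivAt (fun s => w s i) (w' t i) t)
    (hEudiff : Differentiable ℝ Eu) (hEwdiff : Differentiable ℝ Ew)
    (hherm : ∀ t, (H t)ᴴ = H t)
    (heigu : ∀ t, H t *ᵥ u t = fun i => (Eu t : ℂ) * u t i)
    (heigw : ∀ t, H t *ᵥ w t = fun i => (Ew t : ℂ) * w t i)
    (horth : ∀ t, ∑ i, (starRingEnd ℂ) (w t i) * u t i = 0) :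
    ∀ t, ∑ i, (starRingEnd ℂ) (w t i) * (H' t *ᵥ u t) i =
      ((Eu t - Ew t : ℝ) : ℂ) * ∑ i, (starRingEnd ℂ) (w t i) * u' t i := by
  intro t
  have key : ∀ i, (H' t *ᵥ u t) i + (H t *ᵥ u' t) i
      = ((deriv Eu t : ℝ) : ℂ) * u t i + (Eu t : ℂ) * u' t i := by
    intro i
    have h1 : HasDerivAt (fun s => ∑ j, H s i j * u s j)
        (∑ j, (H' t i j * u t j + H t i j * u' t j)) t :=
      HasDerivAt.fun_sum fun j _ => (hHdiff i j t).mul (hudiff j t)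
    have h2 : HasDerivAt (fun s => (Eu s : ℂ) * u s i)
        (((deriv Eu t : ℝ) : ℂ) * u t i + (Eu t : ℂ) * u' t i) t :=
      ((hEudiff t).hasDerivAt.ofReal_comp).mul (hudiff i t)
    have h3 : (fun s => ∑ j, H s i j * u s j) = fun s => (Eu s : ℂ) * u s i := by
      funext s
      exact congrFun (heigu s) i
    rw [h3] at h1
    rw [← h1.unique h2, Finset.sum_add_distrib]
    rfl
  have hw : ∀ j, ∑ i, (starRingEnd ℂ) (w t i) * H t i j
      = (Ew t : ℂ) * (starRingEnd ℂ) (w t j) := by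
    intro j
    have h := congrArg (starRingEnd ℂ) (congrFun (heigw t) j)
    simp only [Matrix.mulVec, dotProduct, map_sum, map_mul, Complex.conj_ofReal] at h
    rw [← h]
    refine Finset.sum_congr rfl fun i _ => ?_
    have h4 : (starRingEnd ℂ) (H t j i) = H t i j := congrFun (congrFun (hherm t) i) j
    rw [h4, mul_comm]
  have hsa : ∑ i, (starRingEnd ℂ) (w t i) * (H t *ᵥ u' t) i
      = (Ew t : ℂ) * ∑ i, (starRingEnd ℂ) (w t i) * u' t i := by
    simp only [Matrix.mulVec, dotProduct, Finset.mul_sum]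
    rw [Finset.sum_comm]
    refine Finset.sum_congr rfl fun j _ => ?_
    rw [← mul_assoc, ← hw j, Finset.sum_mul]
    exact Finset.sum_congr rfl fun i _ => by ring
  have hsum : ∑ i, (starRingEnd ℂ) (w t i) * ((H' t *ᵥ u t) i + (H t *ᵥ u' t) i)
      = ((deriv Eu t : ℝ) : ℂ) * ∑ i, (starRingEnd ℂ) (w t i) * u t i
        + (Eu t : ℂ) * ∑ i, (starRingEnd ℂ) (w t i) * u' t i := by
    rw [Finset.mul_sum, Finset.mul_sum, ← Finset.sum_add_distrib]
    refine Finset.sum_congr rfl fun i _ => ?_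
    rw [key i]
    ring
  simp only [mul_add, Finset.sum_add_distrib] at hsum
  rw [hsa, horth t] at hsum
  push_cast
  linear_combination hsum
end
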